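/- arXiv:2205.10177 — 2 statements merged into one kernel-verified Lean document; each statement's English description precedes it below -/
import Mathlib

section
/- For μ ∈ ℝ, the differential equation −u''(x) + 4u(x) − 6·sech²(x)·u(x) = μ·sech²(x)·u(x) on ℝ admits a nonzero solution u ∈ C²(ℝ; ℝ) with u(x) → 0 as |x| → ∞ if and only if μ = n(n+5) for some nonnegative integer n, i.e. if and only if μ ∈ {0, 6, 14, 24, …}. -/
open MeasureTheory Real Filter

/-- The equation `u'' = (4 - Λ sech²) u` has a nonzero solution `u` that decays at infinity
together with its derivative `v`. -/
def HasDecayingSolution (Λ : ℝ) : Prop :=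
  ∃ u v : ℝ → ℝ, (∀ x, HasDerivAt u (v x) x) ∧
    (∀ x, HasDerivAt v ((4 - Λ * ((cosh x)⁻¹) ^ 2) * u x) x) ∧
    Tendsto u (cocompact ℝ) (nhds 0) ∧ Tendsto v (cocompact ℝ) (nhds 0) ∧ ∃ x, u x ≠ 0

lemma inv_cosh_sq_eq_one_sub_tanh_sq (x : ℝ) : ((cosh x)⁻¹) ^ 2 = 1 - tanh x ^ 2 := by
  have h := cosh_pos x
  rw [tanh_eq_sinh_div_cosh]
  field_simp
  linarith [cosh_sq x]

lemma hasDerivAt_tanh_one_sub_sq (x : ℝ) : HasDerivAt tanh (1 - tanh x ^ 2) x := by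
  have h := (hasDerivAt_sinh x).div (hasDerivAt_cosh x) (cosh_pos x).ne'
  have e : tanh = sinh / cosh := by
    funext y
    exact tanh_eq_sinh_div_cosh y
  rw [e]
  refine h.congr_deriv ?_
  have h := cosh_pos x
  simp only [Pi.div_apply]
  field_simp

lemma tendsto_bdd_mul_zero {l : Filter ℝ} {f g : ℝ → ℝ} (C : ℝ) (hf : ∀ x, |f x| ≤ C)
    (hg : Tendsto g l (nhds 0)) : Tendsto (fun x => f x * g x) l (nhds 0) := by
  have h : Tendsto (fun x => C * |g x|) l (nhds 0) := by
    simpa using (hg.abs).const_mul C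
  refine squeeze_zero_norm (fun x => ?_) h
  rw [norm_eq_abs, abs_mul]
  exact mul_le_mul_of_nonneg_right (hf x) (abs_nonneg _)

lemma abs_potential_le (Λ x : ℝ) : |4 - Λ * ((cosh x)⁻¹) ^ 2| ≤ 4 + |Λ| := by
  have h0 : 0 ≤ ((cosh x)⁻¹) ^ 2 := sq_nonneg _
  have h1 : ((cosh x)⁻¹) ^ 2 ≤ 1 := by
    linarith [inv_cosh_sq_eq_one_sub_tanh_sq x, sq_nonneg (tanh x)]
  calc |4 - Λ * ((cosh x)⁻¹) ^ 2| ≤ |4| + |Λ * ((cosh x)⁻¹) ^ 2| := abs_sub _ _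
    _ = 4 + |Λ| * ((cosh x)⁻¹) ^ 2 := by rw [abs_mul, abs_of_nonneg h0]; norm_num
    _ ≤ 4 + |Λ| := by nlinarith [abs_nonneg Λ]

lemma tendsto_cocompact_zero_iff {f : ℝ → ℝ} :
    Tendsto f (cocompact ℝ) (nhds 0) ↔ ∀ ε > 0, ∃ R, ∀ x, R < |x| → |f x| < ε := by
  rw [← Metric.cobounded_eq_cocompact,
    ((hasBasis_cobounded_norm (E := ℝ)).tendsto_iff Metric.nhds_basis_ball)]
  constructor
  · intro h ε hε
    obtain ⟨R, -, hR⟩ := h ε hε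
    exact ⟨R, fun x hx => by simpa using hR x (by simpa using hx.le)⟩
  · intro h ε hε
    obtain ⟨R, hR⟩ := h ε hε
    refine ⟨R + 1, trivial, fun x hx => ?_⟩
    have hx' : R + 1 ≤ |x| := by simpa using hx
    simpa using hR x (by linarith)

/-- If `u` and `u''` tend to `0` at infinity, so does `u'`. -/
lemma tendsto_deriv_zero {u v w : ℝ → ℝ} (hu : ∀ x, HasDerivAt u (v x) x)
    (hv : ∀ x, HasDerivAt v (w x) x) (hu0 : Tendsto u (cocompact ℝ) (nhds 0))
    (hw0 : Tendsto w (cocompact ℝ) (nhds 0)) : Tendsto v (cocompact ℝ) (nhds 0) := by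
  rw [tendsto_cocompact_zero_iff] at *
  intro ε hε
  obtain ⟨R, hR⟩ := hu0 (ε / 3) (by positivity)
  obtain ⟨S, hS⟩ := hw0 (ε / 3) (by positivity)
  refine ⟨max R S + 1, fun x hx => ?_⟩
  have far : ∀ y, x ≤ y → y ≤ x + 1 → max R S < |y| := by
    intro y h1 h2
    have h3 : |x| ≤ |y| + |x - y| := by
      have := abs_add_le y (x - y)
      simpa using this
    have h4 : |x - y| ≤ 1 := abs_le.mpr ⟨by linarith, by linarith⟩
    linarith
  obtain ⟨c, hc, hc'⟩ := exists_hasDerivAt_eq_slope u v (show x < x + 1 by linarith)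
    (fun y _ => (hu y).continuousAt.continuousWithinAt) (fun y _ => hu y)
  obtain ⟨d, hd, hd'⟩ := exists_hasDerivAt_eq_slope v w hc.1
    (fun y _ => (hv y).continuousAt.continuousWithinAt) (fun y _ => hv y)
  have hcx : 0 < c - x := by linarith [hc.1]
  have e1 : v c = u (x + 1) - u x := by simpa using hc'
  have e2 : v c - v x = w d * (c - x) := by
    rw [hd']
    field_simp
  have b1 := hR x ((le_max_left _ _).trans_lt (far x le_rfl (by linarith)))
  have b2 := hR (x + 1) ((le_max_left _ _).trans_lt (far (x + 1) (by linarith) le_rfl))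
  have b3 := hS d ((le_max_right _ _).trans_lt
    (far d hd.1.le (by linarith [hd.2, hc.2])))
  have b4 : |w d * (c - x)| < ε / 3 := by
    rw [abs_mul, abs_of_pos hcx]
    nlinarith [abs_nonneg (w d), hc.2]
  rw [abs_lt] at *
  constructor <;> linarith [b1.1, b1.2, b2.1, b2.2, b4.1, b4.2]

/-- Below the ground state there are no decaying solutions (Picone's identity with `sech²`). -/
lemma not_hasDecayingSolution_of_lt {Λ : ℝ} (hΛ : Λ < 6) : ¬ HasDecayingSolution Λ := by
  rintro ⟨u, v, hu, hv, hu0, hv0, x₀, hx₀⟩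
  set F : ℝ → ℝ := fun x => u x * v x + 2 * (tanh x * (u x * u x)) with hF
  have hF' : ∀ x, HasDerivAt F
      ((v x + 2 * tanh x * u x) ^ 2 + (6 - Λ) * ((cosh x)⁻¹) ^ 2 * u x ^ 2) x := by
    intro x
    refine (((hu x).mul (hv x)).add
      (((hasDerivAt_tanh_one_sub_sq x).mul ((hu x).mul (hu x))).const_mul 2)).congr_deriv ?_
    rw [inv_cosh_sq_eq_one_sub_tanh_sq]
    simp only [Pi.mul_apply]
    ring
  have hpos : ∀ x, 0 ≤
      (v x + 2 * tanh x * u x) ^ 2 + (6 - Λ) * ((cosh x)⁻¹) ^ 2 * u x ^ 2 := fun x => by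
    have : 0 < 6 - Λ := by linarith
    positivity
  have hmono : Monotone F := monotone_of_hasDerivAt_nonneg hF' hpos
  have huu : Tendsto (fun x => u x * u x) (cocompact ℝ) (nhds 0) := by simpa using hu0.mul hu0
  have hF0 : Tendsto F (cocompact ℝ) (nhds 0) := by
    simpa using (hu0.mul hv0).add
      ((tendsto_bdd_mul_zero 1 (fun x => (abs_tanh_lt_one x).le) huu).const_mul 2)
  have hle : ∀ x, F x ≤ 0 := fun x => hmono.ge_of_tendsto (hF0.mono_left atTop_le_cocompact) x
  have hge : ∀ x, 0 ≤ F x := fun x => hmono.le_of_tendsto (hF0.mono_left atBot_le_cocompact) x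
  have hzero : F = fun _ => 0 := funext fun x => le_antisymm (hle x) (hge x)
  have h := (hF' x₀).unique (hzero ▸ hasDerivAt_const x₀ (0 : ℝ))
  have h6 : 0 < 6 - Λ := by linarith
  have hc := cosh_pos x₀
  have : 0 < (6 - Λ) * ((cosh x₀)⁻¹) ^ 2 * u x₀ ^ 2 := by positivity
  nlinarith [sq_nonneg (v x₀ + 2 * tanh x₀ * u x₀)]

/-- The ladder operator `∂ₓ + ν tanh` shifts `ν(ν+1)` to `ν(ν-1)`. -/
lemma HasDecayingSolution.ladder {ν : ℝ} (hν : ν ^ 2 ≠ 4)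
    (h : HasDecayingSolution (ν * (ν + 1))) : HasDecayingSolution (ν * (ν - 1)) := by
  obtain ⟨u, v, hu, hv, hu0, hv0, x₀, hx₀⟩ := h
  have hw : ∀ x, HasDerivAt (fun x => v x + ν * (tanh x * u x))
      ((4 - ν ^ 2 * ((cosh x)⁻¹) ^ 2) * u x + ν * (tanh x * v x)) x := by
    intro x
    refine ((hv x).add
      (((hasDerivAt_tanh_one_sub_sq x).mul (hu x)).const_mul ν)).congr_deriv ?_
    rw [inv_cosh_sq_eq_one_sub_tanh_sq]
    ring
  refine ⟨fun x => v x + ν * (tanh x * u x),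
    fun x => (4 - ν ^ 2 * ((cosh x)⁻¹) ^ 2) * u x + ν * (tanh x * v x), hw, fun x => ?_,
    ?_, ?_, ?_⟩
  · simp only [inv_cosh_sq_eq_one_sub_tanh_sq]
    have hT := hasDerivAt_tanh_one_sub_sq x
    refine (((((((hT.fun_pow 2).const_sub 1).const_mul (ν ^ 2)).const_sub 4).mul (hu x)).add
      ((hT.mul (hv x)).const_mul ν))).congr_deriv ?_
    rw [inv_cosh_sq_eq_one_sub_tanh_sq]
    ring
  · simpa using hv0.add ((tendsto_bdd_mul_zero 1 (fun x => (abs_tanh_lt_one x).le) hu0).const_mul ν)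
  · simpa using (tendsto_bdd_mul_zero _ (abs_potential_le (ν ^ 2)) hu0).add
      ((tendsto_bdd_mul_zero 1 (fun x => (abs_tanh_lt_one x).le) hv0).const_mul ν)
  · by_contra! hzero
    have h := (hw x₀).unique ((funext hzero : (fun x => v x + ν * (tanh x * u x)) = _) ▸
      hasDerivAt_const x₀ (0 : ℝ))
    have h' := hzero x₀
    rw [inv_cosh_sq_eq_one_sub_tanh_sq] at h
    have : (4 - ν ^ 2) * u x₀ = 0 := by linear_combination h - ν * tanh x₀ * h'
    rcases mul_eq_zero.mp this with h4 | h4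
    · exact hν (by linarith)
    · exact hx₀ h4

lemma tendsto_inv_cosh_cocompact : Tendsto (fun x : ℝ => (cosh x)⁻¹) (cocompact ℝ) (nhds 0) := by
  refine tendsto_inv_atTop_zero.comp (tendsto_atTop_mono (f := fun x : ℝ => |x|) (fun x => ?_) ?_)
  · rw [← cosh_abs]
    exact (self_le_sinh_iff.mpr (abs_nonneg x)).trans (sinh_lt_cosh _).le
  · exact tendsto_norm_cocompact_atTop

lemma hasDecayingSolution_six : HasDecayingSolution 6 := by
  have hs : Tendsto (fun x : ℝ => 1 - tanh x ^ 2) (cocompact ℝ) (nhds 0) := by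
    simp_rw [← inv_cosh_sq_eq_one_sub_tanh_sq]
    simpa using tendsto_inv_cosh_cocompact.pow 2
  refine ⟨fun x => 1 - tanh x ^ 2, fun x => -2 * (tanh x * (1 - tanh x ^ 2)),
    fun x => ?_, fun x => ?_, hs, ?_, 0, by simp⟩
  · refine (((hasDerivAt_tanh_one_sub_sq x).fun_pow 2).const_sub 1).congr_deriv ?_
    ring
  · have hT := hasDerivAt_tanh_one_sub_sq x
    refine ((hT.mul ((hT.fun_pow 2).const_sub 1)).const_mul (-2)).congr_deriv ?_
    rw [inv_cosh_sq_eq_one_sub_tanh_sq]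
    ring
  · simpa using (tendsto_bdd_mul_zero 1 (fun x => (abs_tanh_lt_one x).le) hs).const_mul (-2)

lemma hasDecayingSolution_nat (n : ℕ) : HasDecayingSolution (((n : ℝ) + 2) * (n + 3)) := by
  induction n with
  | zero =>
    convert hasDecayingSolution_six using 1
    norm_num
  | succ n ih =>
    have hn : (0 : ℝ) ≤ n := n.cast_nonneg
    have h : HasDecayingSolution (-((n : ℝ) + 3) * (-((n : ℝ) + 3) + 1)) := by
      convert ih using 1
      ring
    convert h.ladder (by nlinarith) using 1
    push_cast
    ring

lemma exists_nat_of_hasDecayingSolution (N : ℕ) : ∀ ν : ℝ, 1 ≤ ν → ν < N + 2 →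
    HasDecayingSolution (ν * (ν + 1)) → ∃ n : ℕ, ν = n + 2 := by
  induction N with
  | zero =>
    intro ν h1 h2 h
    norm_num at h2
    exact absurd h (not_hasDecayingSolution_of_lt (by nlinarith))
  | succ N ih =>
    intro ν h1 h2 h
    push_cast at h2
    rcases lt_trichotomy ν 2 with h3 | h3 | h3
    · exact absurd h (not_hasDecayingSolution_of_lt (by nlinarith))
    · exact ⟨0, by simpa using h3⟩
    · have h' : HasDecayingSolution ((ν - 1) * (ν - 1 + 1)) := by
        convert h.ladder (by nlinarith) using 1
        ring
      obtain ⟨n, hn⟩ := ih (ν - 1) (by linarith) (by linarith) h'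
      exact ⟨n + 1, by push_cast; linarith⟩

lemma hasDecayingSolution_iff (Λ : ℝ) :
    HasDecayingSolution Λ ↔ ∃ n : ℕ, Λ = ((n : ℝ) + 2) * (n + 3) := by
  refine ⟨fun h => ?_, fun ⟨n, hn⟩ => hn ▸ hasDecayingSolution_nat n⟩
  have h6 : 6 ≤ Λ := not_lt.mp fun h' => not_hasDecayingSolution_of_lt h' h
  set r := √(1 + 4 * Λ) with hr
  have hr2 : r ^ 2 = 1 + 4 * Λ := sq_sqrt (by linarith)
  have hr5 : 5 ≤ r := le_sqrt_of_sq_le (by linarith)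
  have hΛ : Λ = (r - 1) / 2 * ((r - 1) / 2 + 1) := by linarith
  obtain ⟨N, hN⟩ := exists_nat_gt ((r - 1) / 2)
  obtain ⟨n, hn⟩ := exists_nat_of_hasDecayingSolution N ((r - 1) / 2) (by linarith)
    (by linarith) (hΛ ▸ h)
  exact ⟨n, by rw [hΛ, hn]; ring⟩

/-- The spectral problem `-u'' + 4u - 6 sech² u = μ sech² u` admits a nonzero `C²` solution
with `u(x) → 0` as `|x| → ∞` if and only if `μ = n(n+5)` for some `n ∈ ℕ`. -/
theorem stmt_8 (μ : ℝ) :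
    (∃ u : ℝ → ℝ, ContDiff ℝ 2 u ∧ u ≠ 0 ∧
      Tendsto u (cocompact ℝ) (nhds 0) ∧
      ∀ x : ℝ, -(deriv (deriv u) x) + 4 * u x - 6 * ((Real.cosh x)⁻¹)^2 * u x
        = μ * ((Real.cosh x)⁻¹)^2 * u x) ↔
    ∃ n : ℕ, μ = (n : ℝ) * ((n : ℝ) + 5) := by
  have key : HasDecayingSolution (6 + μ) ↔ ∃ n : ℕ, μ = (n : ℝ) * ((n : ℝ) + 5) := by
    rw [hasDecayingSolution_iff]
    refine exists_congr fun n => ⟨fun h => ?_, fun h => ?_⟩ <;> linear_combination h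
  rw [← key]
  constructor
  · rintro ⟨u, hu, hne, hu0, heq⟩
    have h1 : ∀ x, HasDerivAt u (deriv u x) x := fun x =>
      (hu.differentiable (by norm_num) x).hasDerivAt
    have hdu : ContDiff ℝ 1 (deriv u) :=
      ((contDiff_succ_iff_deriv (n := 1)).mp (by simpa [one_add_one_eq_two] using hu)).2.2
    have h2 : ∀ x, HasDerivAt (deriv u) ((4 - (6 + μ) * ((cosh x)⁻¹) ^ 2) * u x) x := fun x =>
      (hdu.differentiable (by norm_num) x).hasDerivAt.congr_deriv
        (by linear_combination - heq x)
    exact ⟨u, deriv u, h1, h2, hu0,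
      tendsto_deriv_zero h1 h2 hu0 (tendsto_bdd_mul_zero _ (abs_potential_le _) hu0),
      Function.ne_iff.mp hne⟩
  · rintro ⟨u, v, hu, hv, hu0, -, hx⟩
    have hdu : deriv u = v := funext fun x => (hu x).deriv
    have hdv : deriv v = fun x => (4 - (6 + μ) * ((cosh x)⁻¹) ^ 2) * u x :=
      funext fun x => (hv x).deriv
    have hud : Differentiable ℝ u := fun x => (hu x).differentiableAt
    have hvd : Differentiable ℝ v := fun x => (hv x).differentiableAt
    refine ⟨u, ?_, Function.ne_iff.mpr hx, hu0, fun x => ?_⟩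
    · rw [← one_add_one_eq_two, contDiff_succ_iff_deriv]
      refine ⟨hud, by simp, ?_⟩
      rw [hdu, contDiff_one_iff_deriv, hdv]
      refine ⟨hvd, ?_⟩
      have hc : Continuous fun x : ℝ => (cosh x)⁻¹ :=
        continuous_cosh.inv₀ fun x => (cosh_pos x).ne'
      have := hud.continuous
      fun_prop
    · rw [hdu, hdv]
      ring
end

section
/- There exist c₀ > 0 and A₀ > 0 such that for every c ∈ (−c₀, c₀) there exists a smooth function U_c: ℝ → ℂ with |U_c(ξ)| < 1 for all ξ, |U_c(ξ)| → 1 as |ξ| → ∞, solving U_c'' − 2ic(1−|U_c|²)U_c' + 2(1−|U_c|²)U_c = 0 on ℝ, such that the function W := U_c − φ + 2ic·v_φ satisfies ‖cosh(·)W''‖²_{L²} + ‖W'‖²_{L²} + ‖sech(·)W‖²_{L²} ≤ A₀²c⁴, where φ(ξ) = tanh(ξ) and v_φ(ξ) = (1/4)sech²(ξ) − 1/2. -/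
open MeasureTheory Real Filter

lemma Real.one_sub_tanh_sq (x : ℝ) : 1 - Real.tanh x ^ 2 = (Real.cosh x)⁻¹ ^ 2 := by
  have h := (Real.cosh_pos x).ne'
  rw [Real.tanh_eq_sinh_div_cosh]
  field_simp
  linarith [Real.cosh_sq x]

lemma Real.hasDerivAt_tanh (x : ℝ) : HasDerivAt Real.tanh (1 - Real.tanh x ^ 2) x := by
  have h := (Real.cosh_pos x).ne'
  have hfun : Real.tanh = fun y => Real.sinh y / Real.cosh y :=
    funext Real.tanh_eq_sinh_div_cosh
  have hd := (Real.hasDerivAt_sinh x).fun_div (Real.hasDerivAt_cosh x) h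
  rw [← hfun] at hd
  refine hd.congr_deriv ?_
  rw [Real.tanh_eq_sinh_div_cosh]
  field_simp

lemma Real.contDiff_tanh {n : WithTop ℕ∞} : ContDiff ℝ n Real.tanh := by
  have hfun : Real.tanh = fun y => Real.sinh y / Real.cosh y :=
    funext Real.tanh_eq_sinh_div_cosh
  rw [hfun]
  exact Real.contDiff_sinh.div Real.contDiff_cosh fun x => (Real.cosh_pos x).ne'

lemma Real.inv_cosh_sq_le (x : ℝ) : (Real.cosh x)⁻¹ ^ 2 ≤ (1 + x ^ 2)⁻¹ := by
  rw [inv_pow]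
  apply inv_anti₀ (by positivity)
  rw [Real.cosh_sq]
  have h : |x| ≤ |Real.sinh x| := by
    rw [Real.abs_sinh]
    exact Real.self_le_sinh_iff.2 (abs_nonneg x)
  linarith [sq_le_sq.2 h]

lemma Real.memLp_two_inv_cosh : MemLp (fun x : ℝ => (Real.cosh x)⁻¹) 2 volume := by
  have hc : Continuous fun x : ℝ => (Real.cosh x)⁻¹ :=
    Real.continuous_cosh.inv₀ fun x => (Real.cosh_pos x).ne'
  rw [memLp_two_iff_integrable_sq hc.aestronglyMeasurable]
  refine integrable_inv_one_add_sq.mono' (hc.pow 2).aestronglyMeasurable (.of_forall fun x => ?_)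
  rw [Real.norm_of_nonneg (by positivity)]
  exact Real.inv_cosh_sq_le x

/-- The explicit dark soliton of speed `2 * m / (1 - m ^ 2)`: a hyperbolic translate of `tanh`. -/
noncomputable def darkSoliton (m ξ : ℝ) : ℂ :=
  ((Real.tanh ξ : ℂ) + Complex.I * m) / (1 - Complex.I * m * Real.tanh ξ)

/-- The derivative of `darkSoliton m`. -/
noncomputable def darkSolitonDeriv (m ξ : ℝ) : ℂ :=
  (1 - (m : ℂ) ^ 2) * (1 - (Real.tanh ξ : ℂ) ^ 2) / (1 - Complex.I * m * Real.tanh ξ) ^ 2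

/-- The second derivative of `darkSoliton m`. -/
noncomputable def darkSolitonDeriv₂ (m ξ : ℝ) : ℂ :=
  (1 - (m : ℂ) ^ 2) * (1 - (Real.tanh ξ : ℂ) ^ 2) *
    (-2 * Real.tanh ξ * (1 - Complex.I * m * Real.tanh ξ)
      + 2 * Complex.I * m * (1 - (Real.tanh ξ : ℂ) ^ 2)) / (1 - Complex.I * m * Real.tanh ξ) ^ 3

lemma one_sub_I_mul_ne_zero (m t : ℝ) : (1 - Complex.I * m * t : ℂ) ≠ 0 := fun h => by
  simpa using congrArg Complex.re h

lemma one_add_I_mul_ne_zero (m t : ℝ) : (1 + Complex.I * m * t : ℂ) ≠ 0 := fun h => by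
  simpa using congrArg Complex.re h

lemma hasDerivAt_ofReal_tanh (ξ : ℝ) :
    HasDerivAt (fun x : ℝ => (Real.tanh x : ℂ)) (1 - (Real.tanh ξ : ℂ) ^ 2) ξ := by
  simpa using (Real.hasDerivAt_tanh ξ).ofReal_comp

lemma hasDerivAt_one_sub_I_mul (m ξ : ℝ) :
    HasDerivAt (fun x : ℝ => (1 - Complex.I * m * Real.tanh x : ℂ))
      (-(Complex.I * m * (1 - (Real.tanh ξ : ℂ) ^ 2))) ξ :=
  ((hasDerivAt_ofReal_tanh ξ).const_mul _).const_sub _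

lemma hasDerivAt_darkSoliton (m ξ : ℝ) :
    HasDerivAt (darkSoliton m) (darkSolitonDeriv m ξ) ξ := by
  have h := one_sub_I_mul_ne_zero m (Real.tanh ξ)
  refine (((hasDerivAt_ofReal_tanh ξ).add_const (Complex.I * m)).fun_div
    (hasDerivAt_one_sub_I_mul m ξ) h).congr_deriv ?_
  rw [darkSolitonDeriv]
  congr 1
  linear_combination ((1 - (Real.tanh ξ : ℂ) ^ 2) * m ^ 2) * Complex.I_sq

lemma hasDerivAt_darkSolitonDeriv (m ξ : ℝ) :
    HasDerivAt (darkSolitonDeriv m) (darkSolitonDeriv₂ m ξ) ξ := by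
  have h := one_sub_I_mul_ne_zero m (Real.tanh ξ)
  refine (((((hasDerivAt_ofReal_tanh ξ).fun_pow 2).const_sub 1).const_mul
    (1 - (m : ℂ) ^ 2)).fun_div
    ((hasDerivAt_one_sub_I_mul m ξ).fun_pow 2) (pow_ne_zero 2 h)).congr_deriv ?_
  rw [darkSolitonDeriv₂]
  push_cast
  generalize hd : (1 - Complex.I * m * Real.tanh ξ : ℂ) = d at *
  field_simp
  ring

lemma contDiff_darkSoliton (m : ℝ) {n : WithTop ℕ∞} : ContDiff ℝ n (darkSoliton m) := by
  have ht : ContDiff ℝ n fun x : ℝ => (Real.tanh x : ℂ) :=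
    Complex.ofRealCLM.contDiff.comp Real.contDiff_tanh
  have hd : ContDiff ℝ n fun x : ℝ => (1 - Complex.I * m * Real.tanh x : ℂ) :=
    contDiff_const.sub (contDiff_const.mul ht)
  have hfun : darkSoliton m = fun x : ℝ => ((Real.tanh x : ℂ) + Complex.I * m)
      * (1 - Complex.I * m * Real.tanh x)⁻¹ := funext fun x => div_eq_mul_inv _ _
  rw [hfun]
  exact (ht.add contDiff_const).mul <| hd.inv fun x => one_sub_I_mul_ne_zero m (Real.tanh x)

lemma normSq_add_I_mul (m t : ℝ) : Complex.normSq ((t : ℂ) + Complex.I * m) = t ^ 2 + m ^ 2 := by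
  simp [Complex.normSq_apply]
  ring

lemma normSq_one_sub_I_mul (m t : ℝ) :
    Complex.normSq (1 - Complex.I * m * t) = 1 + m ^ 2 * t ^ 2 := by
  simp [Complex.normSq_apply]
  ring

lemma one_sub_norm_darkSoliton_sq (m ξ : ℝ) :
    1 - ‖darkSoliton m ξ‖ ^ 2
      = (1 - m ^ 2) * (1 - Real.tanh ξ ^ 2) / (1 + m ^ 2 * Real.tanh ξ ^ 2) := by
  rw [Complex.sq_norm, darkSoliton, Complex.normSq_div, normSq_one_sub_I_mul,
    normSq_add_I_mul]
  field_simp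
  ring

lemma norm_darkSolitonDeriv {m : ℝ} (hm : |m| < 1) (ξ : ℝ) :
    ‖darkSolitonDeriv m ξ‖
      = (1 - m ^ 2) * (1 - Real.tanh ξ ^ 2) / (1 + m ^ 2 * Real.tanh ξ ^ 2) := by
  have h1 : 0 ≤ 1 - m ^ 2 := by linarith [(sq_lt_one_iff_abs_lt_one m).2 hm]
  have h2 : 0 ≤ 1 - Real.tanh ξ ^ 2 := by linarith [Real.tanh_sq_lt_one ξ]
  rw [darkSolitonDeriv, norm_div, norm_pow, Complex.sq_norm, normSq_one_sub_I_mul]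
  congr 1
  rw [← Real.norm_of_nonneg (mul_nonneg h1 h2), ← Complex.norm_real]
  push_cast
  rfl

lemma one_sub_norm_darkSoliton_sq_le {m : ℝ} (ξ : ℝ) :
    1 - ‖darkSoliton m ξ‖ ^ 2 ≤ 1 - Real.tanh ξ ^ 2 := by
  have h2 : 0 ≤ 1 - Real.tanh ξ ^ 2 := by linarith [Real.tanh_sq_lt_one ξ]
  rw [one_sub_norm_darkSoliton_sq]
  apply div_le_of_le_mul₀ (by positivity) h2
  nlinarith [mul_nonneg h2 (sq_nonneg m), mul_nonneg h2 (sq_nonneg (m * Real.tanh ξ))]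

lemma norm_darkSoliton_lt_one {m : ℝ} (hm : |m| < 1) (ξ : ℝ) : ‖darkSoliton m ξ‖ < 1 := by
  have h1 : 0 < 1 - m ^ 2 := by linarith [(sq_lt_one_iff_abs_lt_one m).2 hm]
  have h2 : 0 < 1 - Real.tanh ξ ^ 2 := by linarith [Real.tanh_sq_lt_one ξ]
  have h : 0 < 1 - ‖darkSoliton m ξ‖ ^ 2 := by
    rw [one_sub_norm_darkSoliton_sq]
    positivity
  nlinarith [norm_nonneg (darkSoliton m ξ)]

lemma tendsto_norm_darkSoliton {m : ℝ} (hm : |m| < 1) :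
    Tendsto (fun ξ => ‖darkSoliton m ξ‖) (cocompact ℝ) (nhds 1) := by
  have hsq : Tendsto (fun ξ : ℝ => 1 + ξ ^ 2) (cocompact ℝ) atTop := by
    refine tendsto_atTop_add_const_left _ _ ?_
    have h := (tendsto_pow_atTop two_ne_zero).comp (tendsto_norm_cocompact_atTop (E := ℝ))
    simpa [Function.comp_def] using h
  have hl : Tendsto (fun ξ : ℝ => 1 - (1 + ξ ^ 2)⁻¹) (cocompact ℝ) (nhds 1) := by
    simpa using (tendsto_inv_atTop_zero.comp hsq).const_sub 1
  refine tendsto_of_tendsto_of_tendsto_of_le_of_le hl tendsto_const_nhds (fun ξ => ?_)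
    fun ξ => (norm_darkSoliton_lt_one hm ξ).le
  have h1 := norm_darkSoliton_lt_one hm ξ
  have h2 := one_sub_norm_darkSoliton_sq_le (m := m) ξ
  have h3 := Real.inv_cosh_sq_le ξ
  rw [← Real.one_sub_tanh_sq] at h3
  simp only
  nlinarith [norm_nonneg (darkSoliton m ξ)]

lemma darkSolitonDeriv₂_eq {c m : ℝ} (hcm : c * (1 - m ^ 2) = 2 * m) (ξ : ℝ) :
    darkSolitonDeriv₂ m ξ = ((1 - ‖darkSoliton m ξ‖ ^ 2 : ℝ) : ℂ) *
      (2 * Complex.I * c * darkSolitonDeriv m ξ - 2 * darkSoliton m ξ) := by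
  have h := one_sub_I_mul_ne_zero m (Real.tanh ξ)
  have h' := one_add_I_mul_ne_zero m (Real.tanh ξ)
  have hcm' : (c : ℂ) * (1 - m ^ 2) = 2 * m := by exact_mod_cast hcm
  have hden : (1 + m ^ 2 * Real.tanh ξ ^ 2 : ℂ)
      = (1 - Complex.I * m * Real.tanh ξ) * (1 + Complex.I * m * Real.tanh ξ) := by
    linear_combination (m ^ 2 * (Real.tanh ξ : ℂ) ^ 2) * Complex.I_sq
  rw [one_sub_norm_darkSoliton_sq, darkSolitonDeriv₂, darkSolitonDeriv, darkSoliton]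
  push_cast only [Complex.ofReal_div, Complex.ofReal_mul, Complex.ofReal_sub, Complex.ofReal_add,
    Complex.ofReal_pow, Complex.ofReal_one]
  rw [hden]
  generalize (Real.tanh ξ : ℂ) = t at *
  have key : (1 + Complex.I * m * t) * (-2 * t * (1 - Complex.I * m * t)
      + 2 * Complex.I * m * (1 - t ^ 2)) = 2 * Complex.I * c * ((1 - m ^ 2) * (1 - t ^ 2))
      - 2 * (t + Complex.I * m) * (1 - Complex.I * m * t) := by
    linear_combination (-2 * Complex.I * (1 - t ^ 2)) * hcm'
  generalize hd : (1 - Complex.I * m * t : ℂ) = d at *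
  generalize hd' : (1 + Complex.I * m * t : ℂ) = d' at *
  have hrhs : 2 * Complex.I * c * ((1 - m ^ 2) * (1 - t ^ 2) / d ^ 2)
      - 2 * ((t + Complex.I * m) / d)
      = d' * (-2 * t * d + 2 * Complex.I * m * (1 - t ^ 2)) / d ^ 2 := by
    rw [key]
    field_simp
  rw [hrhs]
  field_simp

lemma norm_darkSolitonDeriv_le {m : ℝ} (hm : |m| < 1) (ξ : ℝ) :
    ‖darkSolitonDeriv m ξ‖ ≤ 1 - Real.tanh ξ ^ 2 := by
  rw [norm_darkSolitonDeriv hm, ← one_sub_norm_darkSoliton_sq]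
  exact one_sub_norm_darkSoliton_sq_le ξ

lemma norm_darkSolitonDeriv₂_le {c m : ℝ} (hcm : c * (1 - m ^ 2) = 2 * m) (hm : |m| < 1)
    (hc : |c| < 1) (ξ : ℝ) :
    ‖darkSolitonDeriv₂ m ξ‖ ≤ 4 * (1 - Real.tanh ξ ^ 2) := by
  have h1 := norm_darkSoliton_lt_one hm ξ
  have h2 := one_sub_norm_darkSoliton_sq_le (m := m) ξ
  have h3 := norm_darkSolitonDeriv_le hm ξ
  have h4 : 0 ≤ 1 - ‖darkSoliton m ξ‖ ^ 2 := by nlinarith [norm_nonneg (darkSoliton m ξ)]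
  have h5 : ‖2 * Complex.I * c * darkSolitonDeriv m ξ - 2 * darkSoliton m ξ‖ ≤ 4 := by
    refine (norm_sub_le _ _).trans ?_
    simp only [norm_mul, Complex.norm_ofNat, Complex.norm_I, mul_one, Complex.norm_real,
      Real.norm_eq_abs]
    have h6 : |c| * ‖darkSolitonDeriv m ξ‖ ≤ 1 :=
      mul_le_one₀ hc.le (norm_nonneg _) (h3.trans (by nlinarith [sq_nonneg (Real.tanh ξ)]))
    linarith
  rw [darkSolitonDeriv₂_eq hcm, norm_mul, Complex.norm_real, Real.norm_of_nonneg h4, mul_comm]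
  exact mul_le_mul h5 h2 h4 (by norm_num)

/-- The remainder of the first-order expansion of the dark soliton in its speed. -/
lemma darkSoliton_remainder {c m : ℝ} (hcm : c * (1 - m ^ 2) = 2 * m) (ξ : ℝ) :
    darkSoliton m ξ - (Real.tanh ξ : ℂ)
        + 2 * Complex.I * (c : ℂ) * (((1/4) * ((Real.cosh ξ)⁻¹)^2 - 1/2 : ℝ) : ℂ)
      = -(c * m / 2 : ℂ) * ((1 + (Real.tanh ξ : ℂ) ^ 2) * darkSoliton m ξ) := by
  have h := one_sub_I_mul_ne_zero m (Real.tanh ξ)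
  have hcm' : (c : ℂ) * (1 - m ^ 2) = 2 * m := by exact_mod_cast hcm
  rw [← Real.one_sub_tanh_sq, darkSoliton]
  push_cast only [Complex.ofReal_div, Complex.ofReal_mul, Complex.ofReal_sub, Complex.ofReal_add,
    Complex.ofReal_pow, Complex.ofReal_one, Complex.ofReal_ofNat]
  generalize (Real.tanh ξ : ℂ) = t at *
  have hq := div_mul_cancel₀ (t + Complex.I * m) h
  apply mul_right_cancel₀ h
  linear_combination (1 + c * m / 2 * (1 + t ^ 2)) * hq - (Complex.I * (1 + t ^ 2) / 2) * hcm'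
    + ((1 + t ^ 2) / 2 * c * m * t) * Complex.I_sq

lemma hasDerivAt_one_add_tanh_sq_mul (m ξ : ℝ) :
    HasDerivAt (fun x : ℝ => (1 + (Real.tanh x : ℂ) ^ 2) * darkSoliton m x)
      (2 * Real.tanh ξ * (1 - (Real.tanh ξ : ℂ) ^ 2) * darkSoliton m ξ
        + (1 + (Real.tanh ξ : ℂ) ^ 2) * darkSolitonDeriv m ξ) ξ := by
  refine ((((hasDerivAt_ofReal_tanh ξ).fun_pow 2).const_add 1).fun_mul
    (hasDerivAt_darkSoliton m ξ)).congr_deriv ?_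
  push_cast
  ring

lemma hasDerivAt_one_add_tanh_sq_mul_deriv (m ξ : ℝ) :
    HasDerivAt (fun x : ℝ => 2 * Real.tanh x * (1 - (Real.tanh x : ℂ) ^ 2) * darkSoliton m x
        + (1 + (Real.tanh x : ℂ) ^ 2) * darkSolitonDeriv m x)
      ((2 - 6 * (Real.tanh ξ : ℂ) ^ 2) * (1 - (Real.tanh ξ : ℂ) ^ 2) * darkSoliton m ξ
        + 4 * Real.tanh ξ * (1 - (Real.tanh ξ : ℂ) ^ 2) * darkSolitonDeriv m ξ
        + (1 + (Real.tanh ξ : ℂ) ^ 2) * darkSolitonDeriv₂ m ξ) ξ := by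
  have ht := hasDerivAt_ofReal_tanh ξ
  refine ((((ht.const_mul 2).fun_mul ((ht.fun_pow 2).const_sub 1)).fun_mul
    (hasDerivAt_darkSoliton m ξ)).fun_add (((ht.fun_pow 2).const_add 1).fun_mul
    (hasDerivAt_darkSolitonDeriv m ξ))).congr_deriv ?_
  push_cast
  ring

lemma norm_one_sub_tanh_sq (ξ : ℝ) :
    ‖(1 - (Real.tanh ξ : ℂ) ^ 2)‖ = 1 - Real.tanh ξ ^ 2 := by
  rw [← Real.norm_of_nonneg (show 0 ≤ 1 - Real.tanh ξ ^ 2 by linarith [Real.tanh_sq_lt_one ξ]),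
    ← Complex.norm_real]
  push_cast
  rfl

lemma norm_one_add_tanh_sq_le (ξ : ℝ) : ‖(1 + (Real.tanh ξ : ℂ) ^ 2)‖ ≤ 2 := by
  refine (norm_add_le _ _).trans ?_
  rw [norm_one, norm_pow, Complex.norm_real, Real.norm_eq_abs, sq_abs]
  linarith [Real.tanh_sq_lt_one ξ]

lemma norm_one_add_tanh_sq_mul_deriv_le {m : ℝ} (hm : |m| < 1) (ξ : ℝ) :
    ‖2 * Real.tanh ξ * (1 - (Real.tanh ξ : ℂ) ^ 2) * darkSoliton m ξ
        + (1 + (Real.tanh ξ : ℂ) ^ 2) * darkSolitonDeriv m ξ‖ ≤ 4 * (1 - Real.tanh ξ ^ 2) := by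
  have hs : 0 ≤ 1 - Real.tanh ξ ^ 2 := by linarith [Real.tanh_sq_lt_one ξ]
  calc _ ≤ 2 * 1 * (1 - Real.tanh ξ ^ 2) * 1 + 2 * (1 - Real.tanh ξ ^ 2) := by
        refine (norm_add_le _ _).trans ?_
        simp only [norm_mul, norm_one_sub_tanh_sq, Complex.norm_real, Real.norm_eq_abs,
          Complex.norm_ofNat]
        gcongr
        · exact (Real.abs_tanh_lt_one ξ).le
        · exact (norm_darkSoliton_lt_one hm ξ).le
        · exact norm_one_add_tanh_sq_le ξ
        · exact norm_darkSolitonDeriv_le hm ξ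
    _ = _ := by ring

lemma norm_one_add_tanh_sq_mul_deriv₂_le {c m : ℝ} (hcm : c * (1 - m ^ 2) = 2 * m) (hm : |m| < 1)
    (hc : |c| < 1) (ξ : ℝ) :
    ‖(2 - 6 * (Real.tanh ξ : ℂ) ^ 2) * (1 - (Real.tanh ξ : ℂ) ^ 2) * darkSoliton m ξ
        + 4 * Real.tanh ξ * (1 - (Real.tanh ξ : ℂ) ^ 2) * darkSolitonDeriv m ξ
        + (1 + (Real.tanh ξ : ℂ) ^ 2) * darkSolitonDeriv₂ m ξ‖
      ≤ 20 * (1 - Real.tanh ξ ^ 2) := by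
  have hs : 0 ≤ 1 - Real.tanh ξ ^ 2 := by linarith [Real.tanh_sq_lt_one ξ]
  have h8 : ‖(2 - 6 * (Real.tanh ξ : ℂ) ^ 2)‖ ≤ 8 := by
    refine (norm_sub_le _ _).trans ?_
    rw [norm_mul, norm_pow, Complex.norm_real, Real.norm_eq_abs, sq_abs, Complex.norm_ofNat,
      Complex.norm_ofNat]
    linarith
  calc _ ≤ 8 * (1 - Real.tanh ξ ^ 2) * 1 + 4 * 1 * (1 - Real.tanh ξ ^ 2) * 1
        + 2 * (4 * (1 - Real.tanh ξ ^ 2)) := by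
        refine norm_add₃_le.trans ?_
        simp only [norm_mul, norm_one_sub_tanh_sq, Complex.norm_real, Real.norm_eq_abs,
          Complex.norm_ofNat]
        gcongr
        · exact (norm_darkSoliton_lt_one hm ξ).le
        · exact (Real.abs_tanh_lt_one ξ).le
        · exact (norm_darkSolitonDeriv_le hm ξ).trans (by linarith [sq_nonneg (Real.tanh ξ)])
        · exact norm_one_add_tanh_sq_le ξ
        · exact norm_darkSolitonDeriv₂_le hcm hm hc ξ
    _ = _ := by ring

lemma exists_speed_parameter (c : ℝ) :
    ∃ m : ℝ, |m| < 1 ∧ |m| ≤ |c| ∧ c * (1 - m ^ 2) = 2 * m := by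
  have hr : 1 ≤ √(1 + c ^ 2) := Real.one_le_sqrt.2 (by nlinarith [sq_nonneg c])
  have hr2 : √(1 + c ^ 2) ^ 2 = 1 + c ^ 2 := Real.sq_sqrt (by positivity)
  have hcr : |c| ≤ √(1 + c ^ 2) := Real.abs_le_sqrt (by linarith)
  set r := √(1 + c ^ 2)
  refine ⟨c / (1 + r), ?_, ?_, ?_⟩
  · rw [abs_div, abs_of_pos (show 0 < 1 + r by linarith), div_lt_one (by linarith)]
    linarith
  · rw [abs_div, abs_of_pos (show 0 < 1 + r by linarith)]
    exact div_le_self (abs_nonneg c) (by linarith)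
  · field_simp
    linear_combination c * hr2

lemma eLpNorm_sq_le_of_norm_le_mul_inv_cosh {f : ℝ → ℂ} {c K : ℝ} (hK : 0 ≤ K)
    (hf : ∀ ξ, ‖f ξ‖ ≤ K * c ^ 2 * (Real.cosh ξ)⁻¹) :
    eLpNorm f 2 volume ^ 2 ≤ ENNReal.ofReal
      (K ^ 2 * (eLpNorm (fun x : ℝ => (Real.cosh x)⁻¹) 2 volume).toReal ^ 2 * c ^ 4) := by
  have h := eLpNorm_le_mul_eLpNorm_of_ae_le_mul (μ := volume) (f := f)
    (g := fun x : ℝ => (Real.cosh x)⁻¹) (c := K * c ^ 2) (.of_forall fun ξ => by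
      simpa [abs_of_pos (Real.cosh_pos ξ)] using hf ξ) 2
  rw [← ENNReal.ofReal_toReal Real.memLp_two_inv_cosh.eLpNorm_ne_top,
    ← ENNReal.ofReal_mul (by positivity)] at h
  calc _ ≤ _ := pow_le_pow_left' h 2
    _ = _ := by
      rw [← ENNReal.ofReal_pow (by positivity)]
      congr 1
      ring

/-- Asymptotic expansion of the dark soliton as `c → 0`: there are `c₀, A₀ > 0` such that
for `|c| < c₀` there is a dark soliton `U_c` with
`‖U_c - φ + 2ic·v_φ‖_{𝓗²₋} ≤ A₀ c²`, where `φ = tanh`, `v_φ = (1/4)sech² - 1/2`. -/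
theorem stmt_12 :
    ∃ c₀ : ℝ, 0 < c₀ ∧ ∃ A₀ : ℝ, 0 < A₀ ∧ ∀ c : ℝ, |c| < c₀ →
      ∃ U : ℝ → ℂ, ContDiff ℝ (⊤ : ℕ∞) U ∧
        (∀ ξ : ℝ, ‖U ξ‖ < 1) ∧
        Tendsto (fun ξ : ℝ => ‖U ξ‖) (cocompact ℝ) (nhds 1) ∧
        (∀ ξ : ℝ, deriv (deriv U) ξ
            - 2 * Complex.I * (c : ℂ) * ((1 - ‖U ξ‖^2 : ℝ) : ℂ) * deriv U ξ
            + 2 * ((1 - ‖U ξ‖^2 : ℝ) : ℂ) * U ξ = 0) ∧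
        (let W : ℝ → ℂ := fun ξ => (U ξ - (Real.tanh ξ : ℂ)
            + 2 * Complex.I * (c : ℂ) * (((1/4) * ((Real.cosh ξ)⁻¹)^2 - 1/2 : ℝ) : ℂ));
          (eLpNorm (fun ξ => Real.cosh ξ • deriv (deriv W) ξ) 2 volume) ^ 2
              + (eLpNorm (deriv W) 2 volume) ^ 2
              + (eLpNorm (fun ξ => (Real.cosh ξ)⁻¹ • W ξ) 2 volume) ^ 2
            ≤ ENNReal.ofReal (A₀^2 * c^4)) := by
  set N := (eLpNorm (fun x : ℝ => (Real.cosh x)⁻¹) 2 volume).toReal with hN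
  have hN0 : 0 ≤ N := ENNReal.toReal_nonneg
  refine ⟨1, one_pos, 20 * N + 1, by positivity, fun c hc => ?_⟩
  obtain ⟨m, hm, hmc, hcm⟩ := exists_speed_parameter c
  have hd : deriv (darkSoliton m) = darkSolitonDeriv m :=
    funext fun ξ => (hasDerivAt_darkSoliton m ξ).deriv
  refine ⟨darkSoliton m, contDiff_darkSoliton m, norm_darkSoliton_lt_one hm,
    tendsto_norm_darkSoliton hm, fun ξ => ?_, ?_⟩
  · rw [hd, (hasDerivAt_darkSolitonDeriv m ξ).deriv, darkSolitonDeriv₂_eq hcm]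
    ring
  intro W
  have hW : W = fun ξ => -(c * m / 2 : ℂ) * ((1 + (Real.tanh ξ : ℂ) ^ 2) * darkSoliton m ξ) :=
    funext (darkSoliton_remainder hcm)
  have hW' := funext fun ξ =>
    ((hasDerivAt_one_add_tanh_sq_mul m ξ).const_mul (-(c * m / 2 : ℂ))).deriv
  have hW'' := funext fun ξ =>
    ((hasDerivAt_one_add_tanh_sq_mul_deriv m ξ).const_mul (-(c * m / 2 : ℂ))).deriv
  rw [← hW] at hW'
  rw [← hW'] at hW''
  have hcoef : ‖-(c * m / 2 : ℂ)‖ ≤ c ^ 2 / 2 := by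
    rw [norm_neg, norm_div, norm_mul, Complex.norm_real, Complex.norm_real, Complex.norm_ofNat,
      Real.norm_eq_abs, Real.norm_eq_abs, ← sq_abs c, sq]
    gcongr
  have hsech (ξ : ℝ) : 0 < (Real.cosh ξ)⁻¹ := inv_pos.2 (Real.cosh_pos ξ)
  have hsech1 (ξ : ℝ) : (Real.cosh ξ)⁻¹ ≤ 1 := inv_le_one_of_one_le₀ (Real.one_le_cosh ξ)
  have b₂ : ∀ ξ, ‖Real.cosh ξ • deriv (deriv W) ξ‖ ≤ 10 * c ^ 2 * (Real.cosh ξ)⁻¹ := fun ξ => by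
    have hcosh := Real.cosh_pos ξ
    have h := norm_one_add_tanh_sq_mul_deriv₂_le hcm hm hc ξ
    rw [Real.one_sub_tanh_sq] at h
    rw [hW'', norm_smul, norm_mul, Real.norm_of_nonneg hcosh.le]
    calc _ ≤ Real.cosh ξ * (c ^ 2 / 2 * (20 * (Real.cosh ξ)⁻¹ ^ 2)) := by gcongr
      _ = _ := by field_simp; ring
  have b₁ : ∀ ξ, ‖deriv W ξ‖ ≤ 2 * c ^ 2 * (Real.cosh ξ)⁻¹ := fun ξ => by
    have h := norm_one_add_tanh_sq_mul_deriv_le hm ξ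
    rw [Real.one_sub_tanh_sq] at h
    rw [hW', norm_mul]
    calc _ ≤ c ^ 2 / 2 * (4 * (Real.cosh ξ)⁻¹ ^ 2) := by gcongr
      _ = 2 * c ^ 2 * ((Real.cosh ξ)⁻¹ * (Real.cosh ξ)⁻¹) := by ring
      _ ≤ _ := by
        gcongr
        exact mul_le_of_le_one_left (hsech ξ).le (hsech1 ξ)
  have b₀ : ∀ ξ, ‖(Real.cosh ξ)⁻¹ • W ξ‖ ≤ 1 * c ^ 2 * (Real.cosh ξ)⁻¹ := fun ξ => by
    rw [hW, norm_smul, Real.norm_of_nonneg (hsech ξ).le]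
    simp only [norm_mul]
    calc _ ≤ (Real.cosh ξ)⁻¹ * (c ^ 2 / 2 * (2 * 1)) := by
          have h0 := hsech ξ
          gcongr
          · exact norm_one_add_tanh_sq_le ξ
          · exact (norm_darkSoliton_lt_one hm ξ).le
      _ = _ := by ring
  refine (add_le_add (add_le_add (eLpNorm_sq_le_of_norm_le_mul_inv_cosh (by norm_num) b₂)
    (eLpNorm_sq_le_of_norm_le_mul_inv_cosh (by norm_num) b₁))
    (eLpNorm_sq_le_of_norm_le_mul_inv_cosh (by norm_num) b₀)).trans ?_
  rw [← hN, ← ENNReal.ofReal_add (by positivity) (by positivity),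
    ← ENNReal.ofReal_add (by positivity) (by positivity), ← add_mul, ← add_mul]
  gcongr
  nlinarith
end
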